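/- arXiv:1404.5756 — 2 statements merged into one kernel-verified Lean document; each statement's English description precedes it below -/
import Mathlib

section
/- With b₀ = 2.490895, b₂ = 1.466003, b₄ = -0.024393, b₆ = 0.178257, for every real t one has |(1/√(2π)) e^{-t²/2} - 1/(b₀ + b₂ t² + b₄ t⁴ + b₆ t⁶)| < 2.7 × 10⁻³. -/
namespace RGA

/-- Horner evaluation of a rational coefficient list at a real point. -/
def ev : List ℚ → ℝ → ℝ
  | [], _ => 0
  | c :: l, x => (c : ℝ) + x * ev l x

def add : List ℚ → List ℚ → List ℚ
  | [], q => q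
  | p, [] => p
  | a :: p, b :: q => (a + b) :: add p q

def smul (k : ℚ) : List ℚ → List ℚ
  | [] => []
  | a :: p => (k * a) :: smul k p

def mul : List ℚ → List ℚ → List ℚ
  | [], _ => []
  | a :: p, q => add (smul a q) (0 :: mul p q)

/-- Taylor shift: composition with `m + h y`. -/
def shift (m h : ℚ) : List ℚ → List ℚ
  | [] => []
  | a :: p => add [a] (mul [m, h] (shift m h p))

theorem ev_add (p q : List ℚ) (x : ℝ) : ev (add p q) x = ev p x + ev q x := by
  induction p generalizing q with
  | nil => simp [add, ev]
  | cons a p ih =>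
    cases q with
    | nil => simp [add, ev]
    | cons b q => simp only [add, ev, ih]; push_cast; ring

theorem ev_smul (k : ℚ) (p : List ℚ) (x : ℝ) : ev (smul k p) x = k * ev p x := by
  induction p with
  | nil => simp [smul, ev]
  | cons a p ih => simp only [smul, ev, ih]; push_cast; ring

theorem ev_mul (p q : List ℚ) (x : ℝ) : ev (mul p q) x = ev p x * ev q x := by
  induction p with
  | nil => simp [mul, ev]
  | cons a p ih => simp only [mul, ev, ev_add, ev_smul, ih]; push_cast; ring

theorem ev_shift (m h : ℚ) (p : List ℚ) (x : ℝ) :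
    ev (shift m h p) x = ev p (m + h * x) := by
  induction p with
  | nil => simp [shift, ev]
  | cons a p ih => simp only [shift, ev, ev_add, ev_mul, ih]; push_cast; ring

/-- Sum of absolute values of the coefficients. -/
def absb : List ℚ → ℚ
  | [] => 0
  | a :: p => |a| + absb p

theorem abs_ev (p : List ℚ) (x : ℝ) (hx : |x| ≤ 1) : |ev p x| ≤ absb p := by
  induction p with
  | nil => simp [absb, ev]
  | cons a p ih =>
    simp only [absb, ev]; push_cast
    have h1 : |x * ev p x| ≤ absb p := by
      rw [abs_mul]
      nlinarith [abs_nonneg x, abs_nonneg (ev p x)]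
    linarith [abs_add_le (a : ℝ) (x * ev p x)]

def okc : List ℚ → Bool
  | [] => false
  | a :: p => decide (absb p < a)

theorem okc_pos (p : List ℚ) (h : okc p = true) (x : ℝ) (hx : |x| ≤ 1) : 0 < ev p x := by
  cases p with
  | nil => simp [okc] at h
  | cons a p =>
    have h1 : absb p < a := by simpa [okc] using h
    have h1' : (absb p : ℝ) < a := by exact_mod_cast h1
    have h2 := abs_ev p x hx
    have h3 : |x * ev p x| ≤ absb p := by
      rw [abs_mul]
      nlinarith [abs_nonneg x, abs_nonneg (ev p x)]
    simp only [ev]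
    linarith [neg_abs_le (x * ev p x)]

/-- Bisection check of positivity on `[-1,1]`. -/
def chk : ℕ → List ℚ → Bool
  | 0, p => okc p
  | n + 1, p => okc p || (chk n (shift (-1/2) (1/2) p) && chk n (shift (1/2) (1/2) p))

theorem chk_pos (n : ℕ) (p : List ℚ) (h : chk n p = true) (x : ℝ) (hx : |x| ≤ 1) :
    0 < ev p x := by
  induction n generalizing p x with
  | zero => exact okc_pos p h x hx
  | succ n ih =>
    simp only [chk, Bool.or_eq_true, Bool.and_eq_true] at h
    rcases h with h | ⟨h1, h2⟩
    · exact okc_pos p h x hx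
    · rw [abs_le] at hx
      rcases le_total x 0 with h0 | h0
      · have := ih _ h1 (2 * x + 1) (by rw [abs_le]; constructor <;> linarith)
        rw [ev_shift] at this
        push_cast at this
        convert this using 2
        ring
      · have := ih _ h2 (2 * x - 1) (by rw [abs_le]; constructor <;> linarith)
        rw [ev_shift] at this
        push_cast at this
        convert this using 2
        ring

def P : List ℚ := [2.490895, 1.466003, -0.024393, 0.178257]

def T : List ℚ := [1, -1, 1/2, -1/6, 1/24, -1/120, 1/720, -1/5040]

def del : ℚ := 9 / (40320 * 8)

def up (a ku : ℚ) : List ℚ :=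
  add [1] (mul (shift a 2 P) (add [27/10000] (smul (-ku) (add [del] T))))

def lo (a kl : ℚ) : List ℚ :=
  add [-1] (mul (shift a 2 P) (add [27/10000] (smul kl (add [-del] T))))

theorem exp_T (s : ℝ) (hs : |s| ≤ 1) : |Real.exp (-s) - ev T s| ≤ del := by
  have h := Real.exp_bound (x := -s) (by simpa using hs) (n := 8) (by norm_num)
  have e : ∑ m ∈ Finset.range 8, (-s) ^ m / (m.factorial : ℝ) = ev T s := by
    simp only [Finset.sum_range_succ, Finset.sum_range_zero, T, ev, Nat.factorial]
    push_cast
    ring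
  rw [e] at h
  refine h.trans ?_
  have : |(-s)| ^ 8 ≤ 1 := pow_le_one₀ (abs_nonneg _) (by simpa using hs)
  simp only [del, Nat.factorial]
  push_cast
  norm_num at this ⊢
  linarith

theorem P_pos (u : ℝ) (hu : 0 ≤ u) : 0 < ev P u := by
  simp only [P, ev]; push_cast
  have : 0 ≤ u * (u - 1) ^ 2 := by positivity
  have : 0 ≤ u ^ 2 := by positivity
  have : 0 ≤ u ^ 3 := by positivity
  nlinarith

theorem piece (n : ℕ) (a kl ku : ℚ) (c : ℝ) (hl0 : 0 ≤ kl)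
    (hl : (kl : ℝ) ≤ c * Real.exp (-a / 2)) (hu : c * Real.exp (-a / 2) ≤ ku)
    (h1 : chk n (up a ku) = true) (h2 : chk n (lo a kl) = true)
    (u : ℝ) (h0 : 0 ≤ u) (ha : |u - a| ≤ 2) :
    |c * Real.exp (-u / 2) - 1 / ev P u| < 2.7e-3 := by
  obtain ⟨s, rfl⟩ : ∃ s : ℝ, u = a + 2 * s := ⟨(u - a) / 2, by ring⟩
  have hs : |s| ≤ 1 := by
    rw [abs_le] at ha ⊢
    constructor <;> linarith [ha.1, ha.2]
  have hp := P_pos _ h0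
  have hT := abs_le.1 (exp_T s hs)
  have p1 := chk_pos n _ h1 s hs
  have p2 := chk_pos n _ h2 s hs
  simp only [up, lo, ev_add, ev_mul, ev_smul, ev_shift] at p1 p2
  simp only [ev] at p1 p2
  push_cast at p1 p2
  have he : c * Real.exp (-(a + 2 * s) / 2) = (c * Real.exp (-a / 2)) * Real.exp (-s) := by
    rw [mul_assoc, ← Real.exp_add]; congr 2; ring
  rw [he]
  set K := c * Real.exp (-a / 2)
  set E := Real.exp (-s)
  have hE : 0 < E := Real.exp_pos _
  have hl0' : (0 : ℝ) ≤ kl := by exact_mod_cast hl0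
  have u1 : K * E ≤ ku * (del + ev T s) := by
    have : K * E ≤ ku * E := mul_le_mul_of_nonneg_right hu hE.le
    have : (ku : ℝ) * E ≤ ku * (del + ev T s) :=
      mul_le_mul_of_nonneg_left (by linarith) (by linarith)
    linarith
  have l1 : kl * (-del + ev T s) ≤ K * E := by
    have : kl * E ≤ K * E := mul_le_mul_of_nonneg_right hl hE.le
    have : (kl : ℝ) * (-del + ev T s) ≤ kl * E :=
      mul_le_mul_of_nonneg_left (by linarith) (by linarith)
    linarith
  set Q := ev P (a + 2 * s)
  have hq : Q * (1 / Q) = 1 := by field_simp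
  rw [abs_lt]
  constructor
  · refine lt_of_mul_lt_mul_left ?_ hp.le
    rw [mul_sub, hq]
    have := mul_le_mul_of_nonneg_left l1 hp.le
    norm_num at *
    nlinarith
  · refine lt_of_mul_lt_mul_left ?_ hp.le
    rw [mul_sub, hq]
    have := mul_le_mul_of_nonneg_left u1 hp.le
    norm_num at *
    nlinarith

theorem c_bounds : (0.398942 : ℝ) ≤ 1 / Real.sqrt (2 * Real.pi) ∧
    1 / Real.sqrt (2 * Real.pi) ≤ 0.398943 := by
  have h1 := Real.pi_gt_d6
  have h2 := Real.pi_lt_d6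
  have hs : 0 < Real.sqrt (2 * Real.pi) := Real.sqrt_pos.2 (by positivity)
  have hq : Real.sqrt (2 * Real.pi) ^ 2 = 2 * Real.pi := Real.sq_sqrt (by positivity)
  constructor
  · rw [le_div_iff₀ hs]
    have : Real.sqrt (2 * Real.pi) ≤ 1 / 0.398942 := by
      apply Real.sqrt_le_iff.2
      constructor
      · norm_num
      · norm_num at *; linarith
    norm_num at *
    linarith
  · rw [div_le_iff₀ hs]
    have : 1 / 0.398943 ≤ Real.sqrt (2 * Real.pi) := by
      apply Real.le_sqrt_of_sq_le
      norm_num at *; linarith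
    norm_num at *
    linarith

theorem exp_bounds (n : ℕ) : (0.367879 : ℝ) ^ n ≤ Real.exp (-n) ∧
    Real.exp (-n) ≤ 0.36788 ^ n := by
  have e : Real.exp (-n) = Real.exp (-1) ^ n := by
    rw [← Real.exp_nat_mul]; congr 1; ring
  have h1 := Real.exp_neg_one_gt_d9
  have h2 := Real.exp_neg_one_lt_d9
  rw [e]
  constructor
  · apply pow_le_pow_left₀ (by norm_num); norm_num at *; linarith
  · apply pow_le_pow_left₀ (Real.exp_pos _).le; norm_num at *; linarith

theorem piece' (k : ℕ) (n : ℕ)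
    (h1 : chk k (up (2 * n) (0.398943 * 0.36788 ^ n)) = true)
    (h2 : chk k (lo (2 * n) (0.398942 * 0.367879 ^ n)) = true)
    (u : ℝ) (h0 : 0 ≤ u) (ha : |u - 2 * n| ≤ 2) :
    |1 / Real.sqrt (2 * Real.pi) * Real.exp (-u / 2) - 1 / ev P u| < 2.7e-3 := by
  obtain ⟨c1, c2⟩ := c_bounds
  obtain ⟨e1, e2⟩ := exp_bounds n
  have e : -(((2 * n : ℚ)) : ℝ) / 2 = -n := by push_cast; ring
  refine piece k _ _ _ _ (by positivity) ?_ ?_ h1 h2 u h0 (by push_cast; exact ha)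
  · rw [e]; push_cast
    exact mul_le_mul c1 e1 (by positivity) (by positivity)
  · rw [e]; push_cast
    exact mul_le_mul c2 e2 (by positivity) (by positivity)

theorem tail (u : ℝ) (hu : 13 ≤ u) :
    |1 / Real.sqrt (2 * Real.pi) * Real.exp (-u / 2) - 1 / ev P u| < 2.7e-3 := by
  obtain ⟨c1, c2⟩ := c_bounds
  obtain ⟨e1, e2⟩ := exp_bounds 6
  have h1 : Real.exp (-u / 2) ≤ 0.36788 ^ 6 :=
    le_trans (Real.exp_le_exp.2 (by push_cast; linarith)) e2
  have h2 := mul_le_mul c2 h1 (Real.exp_pos _).le (by norm_num)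
  have h3 : 0 < 1 / Real.sqrt (2 * Real.pi) * Real.exp (-u / 2) := by positivity
  have h4 : 400 ≤ ev P u := by
    simp only [P, ev]; push_cast
    have : 0 ≤ (u - 13) * u ^ 2 := mul_nonneg (by linarith) (by positivity)
    nlinarith
  have h5 : 1 / ev P u ≤ 1 / 400 := one_div_le_one_div_of_le (by norm_num) h4
  have h6 : 0 < 1 / ev P u := by positivity
  have h7 : (0.398943 : ℝ) * 0.36788 ^ 6 < 2.7e-3 := by norm_num
  have h8 : (1 / 400 : ℝ) < 2.7e-3 := by norm_num
  rw [abs_lt]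
  constructor <;> linarith

theorem main (u : ℝ) (h0 : 0 ≤ u) :
    |1 / Real.sqrt (2 * Real.pi) * Real.exp (-u / 2) - 1 / ev P u| < 2.7e-3 := by
  rcases le_total 13 u with h | h
  · exact tail u h
  rcases le_total u 4 with h4 | h4
  · exact piece' 10 1 (by decide +kernel) (by decide +kernel) u h0
      (by rw [abs_le]; constructor <;> push_cast <;> linarith)
  rcases le_total u 8 with h8 | h8
  · exact piece' 10 3 (by decide +kernel) (by decide +kernel) u h0
      (by rw [abs_le]; constructor <;> push_cast <;> linarith)
  rcases le_total u 12 with h12 | h12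
  · exact piece' 10 5 (by decide +kernel) (by decide +kernel) u h0
      (by rw [abs_le]; constructor <;> push_cast <;> linarith)
  · exact piece' 10 6 (by decide +kernel) (by decide +kernel) u h0
      (by rw [abs_le]; constructor <;> push_cast <;> linarith)

end RGA

theorem rational_gaussian_approx (t : ℝ) :
    |1 / Real.sqrt (2 * Real.pi) * Real.exp (-t ^ 2 / 2) -
      1 / (2.490895 + 1.466003 * t ^ 2 + (-0.024393) * t ^ 4 + 0.178257 * t ^ 6)| <
      2.7e-3 := by
  have h := RGA.main (t ^ 2) (by positivity)
  have e : RGA.ev RGA.P (t ^ 2) =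
      2.490895 + 1.466003 * t ^ 2 + (-0.024393) * t ^ 4 + 0.178257 * t ^ 6 := by
    simp only [RGA.P, RGA.ev]; push_cast; ring
  rw [e] at h
  exact h
end

section
/- If |G(ω) - H(ω)| ≤ ε for all ω, where G(ω) = √(2π)σ e^{-(σω)²/2} and H_σ(ω) = 2πσC²/(b₀ + b₂(σω)² + b₄(σω)⁴ + b₆(σω)⁶) with the Abramowitz–Stegun coefficients and C² = 1, then ε can be taken to be 5.4π σ × 10⁻³; that is, |√(2π)σ e^{-(σω)²/2} - 2πσ/(b₀ + b₂(σω)² + b₄(σω)⁴ + b₆(σω)⁶)| < 5.4πσ × 10⁻³ for all real ω. -/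
/-- The denominator, as a polynomial in `x = t ^ 2 / 2`. -/
def denomPoly (x : ℝ) : ℝ :=
  2.490895 + 2.932006 * x - 0.097572 * x ^ 2 + 1.426056 * x ^ 3

/-- The fifth Taylor polynomial of the exponential. -/
noncomputable def taylorFive (v : ℝ) : ℝ :=
  1 + v + v ^ 2 / 2 + v ^ 3 / 6 + v ^ 4 / 24 + v ^ 5 / 120

lemma exp_taylorFive (v : ℝ) (hv : |v| ≤ 1 / 2) :
    |Real.exp v - taylorFive v| ≤ 0.000026 := by
  have h := Real.exp_bound (x := v) (by linarith) (n := 6) (by norm_num)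
  have h2 : |v| ^ 6 ≤ (1 / 2) ^ 6 := pow_le_pow_left₀ (abs_nonneg v) hv 6
  simp only [Finset.sum_range_succ, Finset.sum_range_zero, Nat.factorial] at h
  norm_num at h
  have e : 1 + v + v ^ 2 / 2 + v ^ 3 / 6 + v ^ 4 / 24 + v ^ 5 / 120 = taylorFive v := rfl
  rw [e] at h
  refine h.trans ?_
  norm_num at h2 ⊢
  linarith

lemma denomPoly_ge (x : ℝ) (hx : 0 ≤ x) : 2.490895 + x + 1.4 * x ^ 3 ≤ denomPoly x := by
  unfold denomPoly
  nlinarith [mul_nonneg hx (sq_nonneg (x - 1)), pow_nonneg hx 3]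

/-- Bernstein basis of degree eight is nonnegative on the unit interval. -/
lemma bern_nonneg (s : ℝ) (h0 : 0 ≤ s) (h1 : s ≤ 1) (j k : ℕ) : 0 ≤ s ^ j * (1 - s) ^ k :=
  mul_nonneg (pow_nonneg h0 j) (pow_nonneg (by linarith) k)

lemma reduce_bounds (g a x lo hi : ℝ) (hlo : 0 ≤ lo) (hx : 0 ≤ x)
    (hg1 : lo ≤ g * Real.exp (-a)) (hg2 : g * Real.exp (-a) ≤ hi)
    (hv : |a - x| ≤ 1 / 2)
    (hA : hi * (taylorFive (a - x) + 0.000026) * denomPoly x < 1 + 0.0027 * denomPoly x)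
    (hB : 1 < lo * (taylorFive (a - x) - 0.000026) * denomPoly x + 0.0027 * denomPoly x) :
    |g * Real.exp (-x) * denomPoly x - 1| < 0.0027 * denomPoly x := by
  have hp : 0 < denomPoly x := by
    have := denomPoly_ge x hx
    have : 0 ≤ x ^ 3 := by positivity
    linarith
  have ht := abs_le.mp (exp_taylorFive _ hv)
  have he : g * Real.exp (-x) = (g * Real.exp (-a)) * Real.exp (a - x) := by
    rw [mul_assoc, ← Real.exp_add]; congr 2; ring
  have hpos := Real.exp_pos (a - x)
  have u1 : g * Real.exp (-x) ≤ hi * (taylorFive (a - x) + 0.000026) := by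
    rw [he]
    exact mul_le_mul hg2 (by linarith [ht.2]) hpos.le (by linarith)
  have u2 : lo * (taylorFive (a - x) - 0.000026) ≤ g * Real.exp (-x) := by
    rw [he]
    calc lo * (taylorFive (a - x) - 0.000026) ≤ lo * Real.exp (a - x) :=
          mul_le_mul_of_nonneg_left (by linarith [ht.1]) hlo
      _ ≤ _ := mul_le_mul_of_nonneg_right hg1 hpos.le
  have w1 := mul_le_mul_of_nonneg_right u1 hp.le
  have w2 := mul_le_mul_of_nonneg_right u2 hp.le
  rw [abs_lt]; constructor <;> linarith

lemma piece_0 (g x : ℝ) (hl : 0 ≤ x) (hr : x ≤ 1/8)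
    (hg1 : 0.398942120825 ≤ g * Real.exp (-0)) (hg2 : g * Real.exp (-0) ≤ 0.398942439978) :
    |g * Real.exp (-x) * denomPoly x - 1| < 0.0027 * denomPoly x := by
  obtain ⟨s, rfl⟩ : ∃ s, x = 0 + 1/8 * s := ⟨(x - 0) / (1/8), by ring⟩
  have b := bern_nonneg s (by linarith) (by linarith)
  refine reduce_bounds g 0 _ _ _ (by norm_num) (by linarith) hg1 hg2
    (abs_le.mpr ⟨by linarith, by linarith⟩) ?_ ?_ <;>
  · unfold taylorFive denomPoly
    linarith [b 0 8, b 1 7, b 2 6, b 3 5, b 4 4, b 5 3, b 6 2, b 7 1, b 8 0]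

lemma piece_1 (g x : ℝ) (hl : 1/8 ≤ x) (hr : x ≤ 1/4)
    (hg1 : 0.398942120825 ≤ g * Real.exp (-0)) (hg2 : g * Real.exp (-0) ≤ 0.398942439978) :
    |g * Real.exp (-x) * denomPoly x - 1| < 0.0027 * denomPoly x := by
  obtain ⟨s, rfl⟩ : ∃ s, x = 1/8 + 1/8 * s := ⟨(x - 1/8) / (1/8), by ring⟩
  have b := bern_nonneg s (by linarith) (by linarith)
  refine reduce_bounds g 0 _ _ _ (by norm_num) (by linarith) hg1 hg2
    (abs_le.mpr ⟨by linarith, by linarith⟩) ?_ ?_ <;>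
  · unfold taylorFive denomPoly
    linarith [b 0 8, b 1 7, b 2 6, b 3 5, b 4 4, b 5 3, b 6 2, b 7 1, b 8 0]

lemma piece_2 (g x : ℝ) (hl : 1/4 ≤ x) (hr : x ≤ 1/2)
    (hg1 : 0.398942120825 ≤ g * Real.exp (-0)) (hg2 : g * Real.exp (-0) ≤ 0.398942439978) :
    |g * Real.exp (-x) * denomPoly x - 1| < 0.0027 * denomPoly x := by
  obtain ⟨s, rfl⟩ : ∃ s, x = 1/4 + 1/4 * s := ⟨(x - 1/4) / (1/4), by ring⟩
  have b := bern_nonneg s (by linarith) (by linarith)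
  refine reduce_bounds g 0 _ _ _ (by norm_num) (by linarith) hg1 hg2
    (abs_le.mpr ⟨by linarith, by linarith⟩) ?_ ?_ <;>
  · unfold taylorFive denomPoly
    linarith [b 0 8, b 1 7, b 2 6, b 3 5, b 4 4, b 5 3, b 6 2, b 7 1, b 8 0]

lemma piece_3 (g x : ℝ) (hl : 1/2 ≤ x) (hr : x ≤ 3/4)
    (hg1 : 0.146762604469 ≤ g * Real.exp (-1)) (hg2 : g * Real.exp (-1) ≤ 0.146762721879) :
    |g * Real.exp (-x) * denomPoly x - 1| < 0.0027 * denomPoly x := by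
  obtain ⟨s, rfl⟩ : ∃ s, x = 1/2 + 1/4 * s := ⟨(x - 1/2) / (1/4), by ring⟩
  have b := bern_nonneg s (by linarith) (by linarith)
  refine reduce_bounds g 1 _ _ _ (by norm_num) (by linarith) hg1 hg2
    (abs_le.mpr ⟨by linarith, by linarith⟩) ?_ ?_ <;>
  · unfold taylorFive denomPoly
    linarith [b 0 8, b 1 7, b 2 6, b 3 5, b 4 4, b 5 3, b 6 2, b 7 1, b 8 0]

lemma piece_4 (g x : ℝ) (hl : 3/4 ≤ x) (hr : x ≤ 1)
    (hg1 : 0.146762604469 ≤ g * Real.exp (-1)) (hg2 : g * Real.exp (-1) ≤ 0.146762721879) :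
    |g * Real.exp (-x) * denomPoly x - 1| < 0.0027 * denomPoly x := by
  obtain ⟨s, rfl⟩ : ∃ s, x = 3/4 + 1/4 * s := ⟨(x - 3/4) / (1/4), by ring⟩
  have b := bern_nonneg s (by linarith) (by linarith)
  refine reduce_bounds g 1 _ _ _ (by norm_num) (by linarith) hg1 hg2
    (abs_le.mpr ⟨by linarith, by linarith⟩) ?_ ?_ <;>
  · unfold taylorFive denomPoly
    linarith [b 0 8, b 1 7, b 2 6, b 3 5, b 4 4, b 5 3, b 6 2, b 7 1, b 8 0]

lemma piece_5 (g x : ℝ) (hl : 1 ≤ x) (hr : x ≤ 3/2)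
    (hg1 : 0.146762604469 ≤ g * Real.exp (-1)) (hg2 : g * Real.exp (-1) ≤ 0.146762721879) :
    |g * Real.exp (-x) * denomPoly x - 1| < 0.0027 * denomPoly x := by
  obtain ⟨s, rfl⟩ : ∃ s, x = 1 + 1/2 * s := ⟨(x - 1) / (1/2), by ring⟩
  have b := bern_nonneg s (by linarith) (by linarith)
  refine reduce_bounds g 1 _ _ _ (by norm_num) (by linarith) hg1 hg2
    (abs_le.mpr ⟨by linarith, by linarith⟩) ?_ ?_ <;>
  · unfold taylorFive denomPoly
    linarith [b 0 8, b 1 7, b 2 6, b 3 5, b 4 4, b 5 3, b 6 2, b 7 1, b 8 0]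

lemma piece_6 (g x : ℝ) (hl : 3/2 ≤ x) (hr : x ≤ 5/2)
    (hg1 : 0.053990944917 ≤ g * Real.exp (-2)) (hg2 : g * Real.exp (-2) ≤ 0.053990988110) :
    |g * Real.exp (-x) * denomPoly x - 1| < 0.0027 * denomPoly x := by
  obtain ⟨s, rfl⟩ : ∃ s, x = 3/2 + 1 * s := ⟨(x - 3/2) / (1), by ring⟩
  have b := bern_nonneg s (by linarith) (by linarith)
  refine reduce_bounds g 2 _ _ _ (by norm_num) (by linarith) hg1 hg2
    (abs_le.mpr ⟨by linarith, by linarith⟩) ?_ ?_ <;>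
  · unfold taylorFive denomPoly
    linarith [b 0 8, b 1 7, b 2 6, b 3 5, b 4 4, b 5 3, b 6 2, b 7 1, b 8 0]

lemma piece_7 (g x : ℝ) (hl : 5/2 ≤ x) (hr : x ≤ 7/2)
    (hg1 : 0.019862158644 ≤ g * Real.exp (-3)) (hg2 : g * Real.exp (-3) ≤ 0.019862174534) :
    |g * Real.exp (-x) * denomPoly x - 1| < 0.0027 * denomPoly x := by
  obtain ⟨s, rfl⟩ : ∃ s, x = 5/2 + 1 * s := ⟨(x - 5/2) / (1), by ring⟩
  have b := bern_nonneg s (by linarith) (by linarith)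
  refine reduce_bounds g 3 _ _ _ (by norm_num) (by linarith) hg1 hg2
    (abs_le.mpr ⟨by linarith, by linarith⟩) ?_ ?_ <;>
  · unfold taylorFive denomPoly
    linarith [b 0 8, b 1 7, b 2 6, b 3 5, b 4 4, b 5 3, b 6 2, b 7 1, b 8 0]

lemma piece_8 (g x : ℝ) (hl : 7/2 ≤ x) (hr : x ≤ 9/2)
    (hg1 : 0.007306879823 ≤ g * Real.exp (-4)) (hg2 : g * Real.exp (-4) ≤ 0.007306885668) :
    |g * Real.exp (-x) * denomPoly x - 1| < 0.0027 * denomPoly x := by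
  obtain ⟨s, rfl⟩ : ∃ s, x = 7/2 + 1 * s := ⟨(x - 7/2) / (1), by ring⟩
  have b := bern_nonneg s (by linarith) (by linarith)
  refine reduce_bounds g 4 _ _ _ (by norm_num) (by linarith) hg1 hg2
    (abs_le.mpr ⟨by linarith, by linarith⟩) ?_ ?_ <;>
  · unfold taylorFive denomPoly
    linarith [b 0 8, b 1 7, b 2 6, b 3 5, b 4 4, b 5 3, b 6 2, b 7 1, b 8 0]

lemma piece_9 (g x : ℝ) (hl : 9/2 ≤ x) (hr : x ≤ 11/2)
    (hg1 : 0.002688050866 ≤ g * Real.exp (-5)) (hg2 : g * Real.exp (-5) ≤ 0.002688053016) :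
    |g * Real.exp (-x) * denomPoly x - 1| < 0.0027 * denomPoly x := by
  obtain ⟨s, rfl⟩ : ∃ s, x = 9/2 + 1 * s := ⟨(x - 9/2) / (1), by ring⟩
  have b := bern_nonneg s (by linarith) (by linarith)
  refine reduce_bounds g 5 _ _ _ (by norm_num) (by linarith) hg1 hg2
    (abs_le.mpr ⟨by linarith, by linarith⟩) ?_ ?_ <;>
  · unfold taylorFive denomPoly
    linarith [b 0 8, b 1 7, b 2 6, b 3 5, b 4 4, b 5 3, b 6 2, b 7 1, b 8 0]

lemma piece_10 (g x : ℝ) (hl : 11/2 ≤ x) (hr : x ≤ 13/2)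
    (hg1 : 0.000988878650 ≤ g * Real.exp (-6)) (hg2 : g * Real.exp (-6) ≤ 0.000988879441) :
    |g * Real.exp (-x) * denomPoly x - 1| < 0.0027 * denomPoly x := by
  obtain ⟨s, rfl⟩ : ∃ s, x = 11/2 + 1 * s := ⟨(x - 11/2) / (1), by ring⟩
  have b := bern_nonneg s (by linarith) (by linarith)
  refine reduce_bounds g 6 _ _ _ (by norm_num) (by linarith) hg1 hg2
    (abs_le.mpr ⟨by linarith, by linarith⟩) ?_ ?_ <;>
  · unfold taylorFive denomPoly
    linarith [b 0 8, b 1 7, b 2 6, b 3 5, b 4 4, b 5 3, b 6 2, b 7 1, b 8 0]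

lemma tail_piece (g x : ℝ) (hx : 13 / 2 ≤ x) (hg0 : 0 ≤ g)
    (hg2 : g * Real.exp (-6) ≤ 0.000988879441) :
    |g * Real.exp (-x) * denomPoly x - 1| < 0.0027 * denomPoly x := by
  have hp := denomPoly_ge x (by linarith)
  have h3 : (13 / 2 : ℝ) ^ 3 ≤ x ^ 3 := pow_le_pow_left₀ (by norm_num) hx 3
  have he : g * Real.exp (-x) ≤ g * Real.exp (-6) :=
    mul_le_mul_of_nonneg_left (Real.exp_le_exp.mpr (by linarith)) hg0
  have h0 : 0 ≤ g * Real.exp (-x) := by positivity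
  have hpp : 380 < denomPoly x := by norm_num at h3; linarith
  rw [abs_lt]
  constructor <;> nlinarith

lemma inv_sqrt_bounds : 0.398942240 ≤ (Real.sqrt (2 * Real.pi))⁻¹ ∧
    (Real.sqrt (2 * Real.pi))⁻¹ ≤ 0.398942320 := by
  have h1 := Real.pi_gt_d20
  have h2 := Real.pi_lt_d20
  have hs : 0 < Real.sqrt (2 * Real.pi) := Real.sqrt_pos.mpr (by positivity)
  have hsq := Real.sq_sqrt (show 0 ≤ 2 * Real.pi by positivity)
  constructor
  · rw [le_inv_comm₀ (by norm_num) hs, Real.sqrt_le_left (by norm_num)]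
    norm_num at h2 ⊢
    linarith
  · rw [inv_le_comm₀ hs (by norm_num)]
    apply Real.le_sqrt_of_sq_le
    norm_num at h1 ⊢
    linarith

lemma core_bound (x : ℝ) (hx : 0 ≤ x) :
    |(Real.sqrt (2 * Real.pi))⁻¹ * Real.exp (-x) * denomPoly x - 1| < 0.0027 * denomPoly x := by
  obtain ⟨g1, g2⟩ := inv_sqrt_bounds
  set g := (Real.sqrt (2 * Real.pi))⁻¹
  have e1 := Real.exp_neg_one_gt_d9
  have e2 := Real.exp_neg_one_lt_d9
  have hb : ∀ n : ℕ, 0.398942240 * (0.36787944116 : ℝ) ^ n ≤ g * Real.exp (-(n : ℝ)) ∧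
      g * Real.exp (-(n : ℝ)) ≤ 0.398942320 * (0.3678794412 : ℝ) ^ n := by
    intro n
    have : Real.exp (-(n : ℝ)) = Real.exp (-1) ^ n := by
      rw [← Real.exp_nat_mul]; congr 1; ring
    rw [this]
    constructor
    · exact mul_le_mul g1 (pow_le_pow_left₀ (by norm_num) e1.le n) (by positivity) (by linarith)
    · exact mul_le_mul g2 (pow_le_pow_left₀ (Real.exp_pos _).le e2.le n) (by positivity)
        (by norm_num)
  have k0 : 0.398942120825 ≤ g * Real.exp (-0) ∧ g * Real.exp (-0) ≤ 0.398942439978 := by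
    have h := hb 0
    push_cast at h
    exact ⟨le_trans (by norm_num) h.1, h.2.trans (by norm_num)⟩
  have k1 : 0.146762604469 ≤ g * Real.exp (-1) ∧ g * Real.exp (-1) ≤ 0.146762721879 := by
    have h := hb 1
    push_cast at h
    exact ⟨le_trans (by norm_num) h.1, h.2.trans (by norm_num)⟩
  have k2 : 0.053990944917 ≤ g * Real.exp (-2) ∧ g * Real.exp (-2) ≤ 0.053990988110 := by
    have h := hb 2
    push_cast at h
    exact ⟨le_trans (by norm_num) h.1, h.2.trans (by norm_num)⟩
  have k3 : 0.019862158644 ≤ g * Real.exp (-3) ∧ g * Real.exp (-3) ≤ 0.019862174534 := by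
    have h := hb 3
    push_cast at h
    exact ⟨le_trans (by norm_num) h.1, h.2.trans (by norm_num)⟩
  have k4 : 0.007306879823 ≤ g * Real.exp (-4) ∧ g * Real.exp (-4) ≤ 0.007306885668 := by
    have h := hb 4
    push_cast at h
    exact ⟨le_trans (by norm_num) h.1, h.2.trans (by norm_num)⟩
  have k5 : 0.002688050866 ≤ g * Real.exp (-5) ∧ g * Real.exp (-5) ≤ 0.002688053016 := by
    have h := hb 5
    push_cast at h
    exact ⟨le_trans (by norm_num) h.1, h.2.trans (by norm_num)⟩
  have k6 : 0.000988878650 ≤ g * Real.exp (-6) ∧ g * Real.exp (-6) ≤ 0.000988879441 := by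
    have h := hb 6
    push_cast at h
    exact ⟨le_trans (by norm_num) h.1, h.2.trans (by norm_num)⟩
  rcases le_total x (1/8) with hup | hnext
  · exact piece_0 g x hx hup k0.1 k0.2
  have hlow := hnext
  rcases le_total x (1/4) with hup | hnext
  · exact piece_1 g x hlow hup k0.1 k0.2
  replace hlow := hnext
  rcases le_total x (1/2) with hup | hnext
  · exact piece_2 g x hlow hup k0.1 k0.2
  replace hlow := hnext
  rcases le_total x (3/4) with hup | hnext
  · exact piece_3 g x hlow hup k1.1 k1.2
  replace hlow := hnext
  rcases le_total x (1) with hup | hnext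
  · exact piece_4 g x hlow hup k1.1 k1.2
  replace hlow := hnext
  rcases le_total x (3/2) with hup | hnext
  · exact piece_5 g x hlow hup k1.1 k1.2
  replace hlow := hnext
  rcases le_total x (5/2) with hup | hnext
  · exact piece_6 g x hlow hup k2.1 k2.2
  replace hlow := hnext
  rcases le_total x (7/2) with hup | hnext
  · exact piece_7 g x hlow hup k3.1 k3.2
  replace hlow := hnext
  rcases le_total x (9/2) with hup | hnext
  · exact piece_8 g x hlow hup k4.1 k4.2
  replace hlow := hnext
  rcases le_total x (11/2) with hup | hnext
  · exact piece_9 g x hlow hup k5.1 k5.2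
  replace hlow := hnext
  rcases le_total x (13/2) with hup | hnext
  · exact piece_10 g x hlow hup k6.1 k6.2
  replace hlow := hnext
  exact tail_piece g x hlow (by linarith) k6.2

theorem fourier_rational_approx_bound (σ : ℝ) (hσ : 0 < σ) (ω : ℝ) :
    |Real.sqrt (2 * Real.pi) * σ * Real.exp (-(σ * ω) ^ 2 / 2) -
      2 * Real.pi * σ /
        (2.490895 + 1.466003 * (σ * ω) ^ 2 + (-0.024393) * (σ * ω) ^ 4 +
          0.178257 * (σ * ω) ^ 6)| < 5.4 * Real.pi * σ * 1e-3 := by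
  generalize σ * ω = t
  have hx : 0 ≤ t ^ 2 / 2 := by positivity
  have hc := core_bound (t ^ 2 / 2) hx
  have hd : 2.490895 + 1.466003 * t ^ 2 + (-0.024393) * t ^ 4 + 0.178257 * t ^ 6
      = denomPoly (t ^ 2 / 2) := by
    unfold denomPoly; ring
  have hp : 0 < denomPoly (t ^ 2 / 2) := by
    have := denomPoly_ge _ hx
    have : 0 ≤ (t ^ 2 / 2) ^ 3 := by positivity
    linarith
  rw [hd, neg_div]
  set p := denomPoly (t ^ 2 / 2)
  set e := Real.exp (-(t ^ 2 / 2))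
  have hs : 0 < Real.sqrt (2 * Real.pi) := Real.sqrt_pos.mpr (by positivity)
  have hsq := Real.mul_self_sqrt (show 0 ≤ 2 * Real.pi by positivity)
  have hroot : Real.sqrt (2 * Real.pi) = 2 * Real.pi * (Real.sqrt (2 * Real.pi))⁻¹ := by
    rw [eq_mul_inv_iff_mul_eq₀ hs.ne']; exact hsq
  have key : Real.sqrt (2 * Real.pi) * σ * e - 2 * Real.pi * σ / p
      = (2 * Real.pi * σ / p) * ((Real.sqrt (2 * Real.pi))⁻¹ * e * p - 1) := by
    conv_lhs => rw [hroot]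
    field_simp
  have hk : 0 < 2 * Real.pi * σ / p := by positivity
  rw [key, abs_mul, abs_of_pos hk]
  calc _ < (2 * Real.pi * σ / p) * (0.0027 * p) := mul_lt_mul_of_pos_left hc hk
    _ = _ := by field_simp; norm_num
end
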